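/- Let γ > 0 and ν > 0 and define φ₊(t) = 1 − e^{γt}(cos(νt) − (γ/ν) sin(νt)). Then there exists a unique t̂ ∈ (π/ν, 2π/ν) with φ₊(t̂) = 0. -/

import Mathlib

open Real

/-- For `γ > 0`, `ν > 0`, the function `φ₊(t) = 1 - e^{γt}(cos(νt) - (γ/ν) sin(νt))`
has a unique zero in `(π/ν, 2π/ν)`. -/
theorem stmt_7 (γ ν : ℝ) (hγ : 0 < γ) (hν : 0 < ν) :
    ∃! th : ℝ, th ∈ Set.Ioo (π / ν) (2 * π / ν) ∧
      1 - Real.exp (γ * th) * (Real.cos (ν * th) - (γ / ν) * Real.sin (ν * th)) = 0 := by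
  set f : ℝ → ℝ := fun t =>
    1 - Real.exp (γ * t) * (Real.cos (ν * t) - (γ / ν) * Real.sin (ν * t)) with hf
  have hder : ∀ t, HasDerivAt f (Real.exp (γ * t) * ((γ ^ 2 / ν + ν) * Real.sin (ν * t))) t := by
    intro t
    have h1 : HasDerivAt (fun t : ℝ => γ * t) γ t := by
      simpa using (hasDerivAt_id t).const_mul γ
    have h2 : HasDerivAt (fun t : ℝ => ν * t) ν t := by
      simpa using (hasDerivAt_id t).const_mul ν
    have h := (h1.exp.mul (h2.cos.sub (h2.sin.const_mul (γ / ν)))).const_sub 1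
    refine h.congr_deriv ?_
    simp only [Pi.sub_apply]
    field_simp
    ring
  have hcont : Continuous f := by
    rw [hf]; fun_prop
  have hanti : StrictAntiOn f (Set.Icc (π / ν) (2 * π / ν)) := by
    apply strictAntiOn_of_deriv_neg (convex_Icc _ _) hcont.continuousOn
    intro x hx
    rw [interior_Icc] at hx
    rw [(hder x).deriv]
    have ha : π < ν * x := by
      have := (div_lt_iff₀ hν).1 hx.1
      linarith
    have hb : ν * x < 2 * π := by
      have := (lt_div_iff₀ hν).1 hx.2
      linarith
    have hs : Real.sin (ν * x) < 0 := by
      have := Real.sin_neg_of_neg_of_neg_pi_lt (x := ν * x - 2 * π) (by linarith) (by linarith)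
      rwa [Real.sin_sub_two_pi] at this
    exact mul_neg_of_pos_of_neg (Real.exp_pos _) (mul_neg_of_pos_of_neg (by positivity) hs)
  have hle : π / ν ≤ 2 * π / ν := by
    gcongr
    linarith [Real.pi_pos]
  have hfa : 0 < f (π / ν) := by
    have : ν * (π / ν) = π := by field_simp
    simp only [hf, this, Real.cos_pi, Real.sin_pi]
    have := Real.exp_pos (γ * (π / ν))
    linarith
  have hfb : f (2 * π / ν) < 0 := by
    have : ν * (2 * π / ν) = 2 * π := by field_simp
    simp only [hf, this, Real.cos_two_pi, Real.sin_two_pi]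
    have hp : 0 < γ * (2 * π / ν) := by positivity
    have := Real.one_lt_exp_iff.2 hp
    linarith
  obtain ⟨t, ht, h0⟩ := intermediate_value_Ioo' hle hcont.continuousOn ⟨hfb, hfa⟩
  refine ⟨t, ⟨ht, h0⟩, ?_⟩
  rintro s ⟨hs, hs0⟩
  exact hanti.injOn (Set.Ioo_subset_Icc_self hs) (Set.Ioo_subset_Icc_self ht)
    (show f s = f t from Eq.trans hs0 h0.symm)
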